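/- WZ sum equals 1 for Re(b) < 0: Let a, b be complex numbers with Re(b) < 0, and suppose the nonvanishing hypotheses of the WZ-pair for Kummer's theorem hold. Then for every nonnegative integer n, ∑_{k=0}^∞ F(n,k) = 1. Equivalently, ∑_{k=0}^∞ (a+2n)_k (b)_k (−1)^k / ((1+a+2n−b)_k k!) = Γ(1+a/2+n) Γ(1+a+2n−b) / (Γ(1+a+2n) Γ(1+a/2+n−b)). -/

import Mathlib

open Complex Finset Filter Topology

/-- The Pochhammer symbol `(x)_k = x (x+1) ⋯ (x+k-1)`. -/
noncomputable def poch (x : ℂ) (k : ℕ) : ℂ := (ascPochhammer ℂ k).eval x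

/-- The WZ summand for Kummer's theorem:
`F(n,k) = (a+2n)_k (b)_k (-1)^k / ((1+a+2n-b)_k k!) ·
  Γ(1+a+2n) Γ(1+a/2+n-b) / (Γ(1+a/2+n) Γ(1+a+2n-b))`. -/
noncomputable def kummerF (a b : ℂ) (n k : ℕ) : ℂ :=
  poch (a + 2 * n) k * poch b k * (-1 : ℂ) ^ k /
    (poch (1 + a + 2 * n - b) k * (Nat.factorial k : ℂ)) *
  (Gamma (1 + a + 2 * n) * Gamma (1 + a / 2 + n - b) /
    (Gamma (1 + a / 2 + n) * Gamma (1 + a + 2 * n - b)))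

/-- The WZ certificate `C(n,k) = -(b-1)k / ((1+a+2n-b+k)(a+2n))`. -/
noncomputable def kummerC (a b : ℂ) (n k : ℕ) : ℂ :=
  -((b - 1) * k) / ((1 + a + 2 * n - b + k) * (a + 2 * n))

/-- `G(n,k) = F(n,k) · C(n,k)`. -/
noncomputable def kummerG (a b : ℂ) (n k : ℕ) : ℂ :=
  kummerF a b n k * kummerC a b n k

theorem poch_zero (x : ℂ) : poch x 0 = 1 := by simp [poch]

theorem poch_succ (x : ℂ) (k : ℕ) : poch x (k + 1) = poch x k * (x + k) := by
  simp [poch, ascPochhammer_succ_eval]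

theorem poch_add_one_mul (x : ℂ) (k : ℕ) : poch (x + 1) k * x = poch x k * (x + k) := by
  induction k with
  | zero => simp [poch_zero]
  | succ k ih =>
    rw [poch_succ, poch_succ]
    push_cast
    linear_combination (x + 1 + k) * ih

theorem poch_ne_zero {x : ℂ} (hx : ∀ k : ℕ, x + k ≠ 0) (k : ℕ) : poch x k ≠ 0 := by
  induction k with
  | zero => simp [poch_zero]
  | succ k ih => rw [poch_succ]; exact mul_ne_zero ih (hx k)

/-- If `Re b < 0`, then the coefficients `(b)_k / k!` are absolutely summable. -/
theorem summable_norm_poch_div_factorial {b : ℂ} (hb : b.re < 0) :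
    Summable fun k : ℕ => ‖poch b k / (k.factorial : ℂ)‖ := by
  set u : ℕ → ℝ := fun k => ‖poch b k / (k.factorial : ℂ)‖ with hu
  have hu0 : ∀ k, 0 ≤ u k := fun k => norm_nonneg _
  have hrec : ∀ k : ℕ, ((k : ℝ) + 1) * u (k + 1) = ‖b + k‖ * u k := by
    intro k
    have hk : ((k : ℂ) + 1) ≠ 0 := Nat.cast_add_one_ne_zero k
    have hf : (k.factorial : ℂ) ≠ 0 := Nat.cast_ne_zero.2 k.factorial_ne_zero
    have h1 : ‖(k : ℂ) + 1‖ = (k : ℝ) + 1 := by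
      exact_mod_cast Complex.norm_natCast (k + 1)
    rw [hu, ← h1]
    simp only
    rw [← norm_mul, ← norm_mul, poch_succ, Nat.factorial_succ]
    congr 1
    push_cast
    field_simp
  obtain ⟨δ, hδ⟩ : ∃ δ : ℝ, δ = -b.re / 2 := ⟨_, rfl⟩
  have hδ0 : 0 < δ := by linarith
  obtain ⟨T, hT⟩ := exists_nat_ge (‖b‖ ^ 2 / (-b.re) + δ)
  have hnorm : ∀ k : ℕ, T ≤ k → ‖b + k‖ ≤ k - δ := by
    intro k hk
    have hk' : ‖b‖ ^ 2 / (-b.re) + δ ≤ (k : ℝ) := hT.trans (by exact_mod_cast hk)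
    have h2 : ‖b‖ ^ 2 / (-b.re) ≤ k := by linarith
    rw [div_le_iff₀ (by linarith)] at h2
    have h3 : 0 ≤ ‖b‖ ^ 2 / (-b.re) := div_nonneg (sq_nonneg _) (by linarith)
    refine abs_le_of_sq_le_sq' ?_ (by linarith) |>.2
    rw [Complex.sq_norm, Complex.normSq_apply] at h2 ⊢
    simp only [add_re, natCast_re, add_im, natCast_im, add_zero]
    nlinarith [sq_nonneg δ]
  have htel : ∀ k : ℕ, T ≤ k → δ * u k ≤ k * u k - (k + 1 : ℕ) * u (k + 1) := by
    intro k hk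
    push_cast
    rw [hrec]
    nlinarith [mul_le_mul_of_nonneg_right (hnorm k hk) (hu0 k)]
  refine (summable_nat_add_iff T).1 ?_
  refine summable_of_sum_range_le (c := T * u T / δ) (fun k => hu0 _) fun N => ?_
  rw [le_div_iff₀ hδ0]
  have h : (∑ k ∈ range N, u (k + T)) * δ ≤ T * u T - ((N + T : ℕ) : ℝ) * u (N + T) := by
    induction N with
    | zero => simp
    | succ N ih =>
      rw [sum_range_succ, add_mul]
      have := htel (N + T) (by omega)
      rw [show N + 1 + T = N + T + 1 by omega]
      linarith
  have : 0 ≤ ((N + T : ℕ) : ℝ) * u (N + T) := mul_nonneg (Nat.cast_nonneg _) (hu0 _)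
  linarith

theorem choose_neg_eq_poch (b : ℂ) (k : ℕ) :
    Ring.choose (-b) k = (-1) ^ k * (poch b k / (k.factorial : ℂ)) := by
  have hf : (k.factorial : ℂ) ≠ 0 := Nat.cast_ne_zero.2 k.factorial_ne_zero
  have h := Ring.factorial_nsmul_multichoose_eq_ascPochhammer b k
  rw [Polynomial.ascPochhammer_smeval_eq_eval, Ring.multichoose_eq, nsmul_eq_mul] at h
  rw [Ring.choose_neg, poch, ← h, mul_div_cancel_left₀ _ hf]
  simp [Units.smul_def]

/-- The binomial series `∑ (-1)^k (b)_k / k! = 2^(-b)`, on the boundary of its disc of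
convergence. -/
theorem tsum_neg_one_pow_mul_poch_div_factorial {b : ℂ} (hb : b.re < 0) :
    ∑' k : ℕ, (-1) ^ k * (poch b k / (k.factorial : ℂ)) = 2 ^ (-b) := by
  have hs : Summable fun k : ℕ => (-1) ^ k * (poch b k / (k.factorial : ℂ)) :=
    .of_norm (by simpa using summable_norm_poch_div_factorial hb)
  have habel := Complex.tendsto_tsum_powerSeries_nhdsWithin_lt hs.hasSum.tendsto_sum_nat
  rw [tendsto_map'_iff] at habel
  refine tendsto_nhds_unique habel ?_
  have hcont : Tendsto (fun x : ℝ => (1 + (x : ℂ)) ^ (-b)) (𝓝[<] 1) (𝓝 (2 ^ (-b))) := by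
    have : ContinuousAt (fun x : ℝ => (1 + (x : ℂ)) ^ (-b)) 1 := by
      refine ContinuousAt.cpow (by fun_prop) continuousAt_const ?_
      simp [Complex.mem_slitPlane_iff]
    have h := this.tendsto.mono_left (nhdsWithin_le_nhds (s := Set.Iio 1))
    norm_num at h
    simpa using h
  refine hcont.congr' ?_
  filter_upwards [Ioo_mem_nhdsLT (show (0 : ℝ) < 1 by norm_num)] with x hx
  have h := (Complex.one_add_cpow_hasFPowerSeriesOnBall_zero (a := -b)).hasSum
    (y := (x : ℂ)) (by
      rw [← ENNReal.ofReal_one, Metric.eball_ofReal]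
      simpa [abs_of_pos hx.1] using hx.2)
  rw [zero_add] at h
  rw [← h.tsum_eq]
  refine tsum_congr fun k => ?_
  rw [binomialSeries_apply, choose_neg_eq_poch]
  simp

theorem add_natCast_ne_zero_of_Gamma_ne_zero {z : ℂ} (hz : Gamma z ≠ 0) (n : ℕ) : z + n ≠ 0 :=
  fun h => hz <| (Gamma_eq_zero_iff z).2 ⟨n, eq_neg_of_add_eq_zero_left h⟩

theorem prod_range_add_mul_Gamma {z : ℂ} (hz : Gamma z ≠ 0) (n : ℕ) :
    (∏ j ∈ range n, (z + j)) * Gamma z = Gamma (z + n) := by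
  induction n with
  | zero => simp
  | succ n ih =>
    have := add_natCast_ne_zero_of_Gamma_ne_zero hz n
    rw [prod_range_succ, mul_right_comm, ih]
    push_cast
    rw [← add_assoc, Gamma_add_one _ this, mul_comm]

theorem tendsto_add_div_add_natCast (z w : ℂ) :
    Tendsto (fun n : ℕ => (z + n) / (w + n)) atTop (𝓝 1) := by
  simpa using tendsto_add_mul_div_add_mul_atTop_nhds z w 1 one_ne_zero

/-- `Γ(z + n) ∼ n^(z-1) n!`. -/
theorem tendsto_Gamma_add_natCast_div {z : ℂ} (hz : Gamma z ≠ 0) :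
    Tendsto (fun n : ℕ => Gamma (z + n) / ((n : ℂ) ^ (z - 1) * (n.factorial : ℂ)))
      atTop (𝓝 1) := by
  have h := ((tendsto_const_nhds (x := Gamma z)).div (GammaSeq_tendsto_Gamma z) hz).mul
    (tendsto_add_div_add_natCast 0 z)
  rw [div_self hz, one_mul] at h
  refine h.congr' ?_
  filter_upwards [eventually_ne_atTop 0] with n hn
  have hn' : (n : ℂ) ≠ 0 := Nat.cast_ne_zero.2 hn
  have hne := add_natCast_ne_zero_of_Gamma_ne_zero hz n
  have hf : (n.factorial : ℂ) ≠ 0 := Nat.cast_ne_zero.2 n.factorial_ne_zero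
  have hc : (n : ℂ) ^ z ≠ 0 := by simp [cpow_eq_zero_iff, hn']
  simp only [Pi.div_apply]
  rw [GammaSeq, prod_range_succ, cpow_sub _ _ hn', cpow_one, ← prod_range_add_mul_Gamma hz n]
  field_simp
  ring

/-- The Gamma factor of `kummerF` tends to `2^b`. -/
theorem tendsto_Gamma_ratio {a b : ℂ} (h3 : Gamma (1 + a) ≠ 0) (h4 : Gamma (1 + a / 2 - b) ≠ 0)
    (h5 : Gamma (1 + a / 2) ≠ 0) (h6 : Gamma (1 + a - b) ≠ 0) :
    Tendsto (fun n : ℕ => Gamma (1 + a + 2 * n) * Gamma (1 + a / 2 + n - b) /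
      (Gamma (1 + a / 2 + n) * Gamma (1 + a + 2 * n - b))) atTop (𝓝 (2 ^ b)) := by
  have hd : Tendsto (fun n : ℕ => 2 * n) atTop atTop :=
    tendsto_id.const_mul_atTop' two_pos
  have h := ((((tendsto_Gamma_add_natCast_div h3).comp hd).mul
    (tendsto_Gamma_add_natCast_div h4)).div ((tendsto_Gamma_add_natCast_div h5).mul
    ((tendsto_Gamma_add_natCast_div h6).comp hd)) (by norm_num)).mul_const ((2 : ℂ) ^ b)
  norm_num at h
  refine h.congr' ?_
  filter_upwards [eventually_ne_atTop 0] with n hn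
  have hn' : (n : ℂ) ≠ 0 := Nat.cast_ne_zero.2 hn
  have hf : ((2 * n).factorial : ℂ) ≠ 0 := Nat.cast_ne_zero.2 (Nat.factorial_ne_zero _)
  have hf' : (n.factorial : ℂ) ≠ 0 := Nat.cast_ne_zero.2 (Nat.factorial_ne_zero _)
  have hc (z : ℂ) : (n : ℂ) ^ z ≠ 0 := by simp [cpow_eq_zero_iff, hn']
  have hc2 (z : ℂ) : (2 : ℂ) ^ z ≠ 0 := by simp [cpow_eq_zero_iff]
  have hmul (z : ℂ) : (2 * (n : ℂ)) ^ z = 2 ^ z * (n : ℂ) ^ z := by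
    exact_mod_cast natCast_mul_natCast_cpow 2 n z
  have e1 : 1 + a - b - 1 = a - b := by ring
  have e2 : 1 + a / 2 - b - 1 = a / 2 - b := by ring
  have e3 : 1 + a / 2 - b + n = 1 + a / 2 + n - b := by ring
  have e4 : 1 + a - b + 2 * n = 1 + a + 2 * n - b := by ring
  simp only [hmul, e1, e2, e3, e4]
  rw [cpow_sub _ _ hn', cpow_sub _ _ hn', cpow_sub _ _ two_ne_zero]
  have := hc a
  have := hc b
  have := hc (a / 2)
  have := hc2 a
  have := hc2 b
  field_simp

/-- Far enough to the right, adding `1 - b` with `Re b < 0` does not decrease the norm. -/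
theorem exists_forall_norm_add_natCast_le (a : ℂ) {b : ℂ} (hb : b.re < 0) :
    ∃ T : ℕ, ∀ t : ℕ, T ≤ t → ‖a + t‖ ≤ ‖1 + a - b + t‖ := by
  obtain ⟨T, hT⟩ := exists_nat_ge (a.im * b.im / (1 - b.re) - a.re)
  refine ⟨T, fun t ht => ?_⟩
  have ht' : a.im * b.im / (1 - b.re) ≤ a.re + t := by
    have : (T : ℝ) ≤ t := by exact_mod_cast ht
    linarith
  rw [div_le_iff₀ (by linarith)] at ht'
  refine abs_le_of_sq_le_sq' ?_ (norm_nonneg _) |>.2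
  rw [Complex.sq_norm, Complex.normSq_apply, Complex.sq_norm, Complex.normSq_apply]
  simp only [add_re, natCast_re, add_im, natCast_im, add_zero, sub_re, sub_im, one_re, one_im]
  nlinarith [sq_nonneg (1 - b.re), sq_nonneg b.im]

theorem norm_poch_div_poch_le_one {x y : ℂ} (h : ∀ k : ℕ, ‖x + k‖ ≤ ‖y + k‖) (k : ℕ) :
    ‖poch x k / poch y k‖ ≤ 1 := by
  induction k with
  | zero => simp [poch_zero]
  | succ k ih =>
    rw [poch_succ, poch_succ, mul_div_mul_comm, norm_mul, norm_div (x + k)]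
    exact mul_le_one₀ ih (by positivity) (div_le_one_of_le₀ (h k) (norm_nonneg _))

theorem exists_norm_poch_div_poch_le {x y : ℂ} {T : ℕ}
    (h : ∀ k : ℕ, T ≤ k → ‖x + k‖ ≤ ‖y + k‖) :
    ∃ K : ℝ, ∀ k : ℕ, T ≤ k → ‖poch x k / poch y k‖ ≤ K := by
  refine ⟨‖poch x T / poch y T‖, fun k hk => ?_⟩
  induction k, hk using Nat.le_induction with
  | base => exact le_rfl
  | succ k hk ih =>
    rw [poch_succ, poch_succ, mul_div_mul_comm, norm_mul, norm_div (x + k)]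
    exact (mul_le_of_le_one_right (norm_nonneg _)
      (div_le_one_of_le₀ (h k hk) (norm_nonneg _))).trans ih

theorem kummer_term_eq (x b y : ℂ) (k : ℕ) :
    poch x k * poch b k * (-1 : ℂ) ^ k / (poch y k * (k.factorial : ℂ)) =
      poch x k / poch y k * ((-1) ^ k * (poch b k / (k.factorial : ℂ))) := by
  rw [mul_assoc, mul_div_mul_comm]
  ring

theorem summable_kummer_term (a : ℂ) {b : ℂ} (hb : b.re < 0) :
    Summable fun k : ℕ => poch a k * poch b k * (-1 : ℂ) ^ k /
      (poch (1 + a - b) k * (k.factorial : ℂ)) := by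
  obtain ⟨T, hT⟩ := exists_forall_norm_add_natCast_le a hb
  obtain ⟨K, hK⟩ := exists_norm_poch_div_poch_le hT
  refine .of_norm_bounded_eventually_nat
    ((summable_norm_poch_div_factorial hb).mul_left K) ?_
  filter_upwards [eventually_ge_atTop T] with k hk
  rw [kummer_term_eq, norm_mul]
  refine mul_le_mul (hK k hk) ?_ (norm_nonneg _) ((norm_nonneg _).trans (hK k hk))
  simp

theorem tendsto_poch_div_poch (a b : ℂ) (k : ℕ) :
    Tendsto (fun n : ℕ => poch (a + 2 * n) k / poch (1 + a + 2 * n - b) k) atTop (𝓝 1) := by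
  induction k with
  | zero => simp [poch_zero]
  | succ k ih =>
    have h := ih.mul (tendsto_add_mul_div_add_mul_atTop_nhds (a + k) (1 + a - b + k) 2
      (two_ne_zero (α := ℂ)))
    rw [div_self two_ne_zero, one_mul] at h
    refine h.congr fun n => ?_
    rw [poch_succ, poch_succ, mul_div_mul_comm]
    ring_nf

theorem tendsto_tsum_kummer_term (a : ℂ) {b : ℂ} (hb : b.re < 0) :
    Tendsto (fun n : ℕ => ∑' k : ℕ, poch (a + 2 * n) k * poch b k * (-1 : ℂ) ^ k /
      (poch (1 + a + 2 * n - b) k * (k.factorial : ℂ))) atTop (𝓝 (2 ^ (-b))) := by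
  rw [← tsum_neg_one_pow_mul_poch_div_factorial hb]
  refine tendsto_tsum_of_dominated_convergence (summable_norm_poch_div_factorial hb)
    (fun k => ?_) ?_
  · simp_rw [kummer_term_eq]
    simpa using (tendsto_poch_div_poch a b k).mul_const _
  · obtain ⟨T, hT⟩ := exists_forall_norm_add_natCast_le a hb
    filter_upwards [eventually_ge_atTop T] with n hn k
    rw [kummer_term_eq, norm_mul]
    refine (mul_le_of_le_one_left (norm_nonneg _) (norm_poch_div_poch_le_one (fun j => ?_) k)).trans
      (by simp)
    convert hT (2 * n + j) (by omega) using 2 <;> push_cast <;> ring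

theorem kummerF_succ_right (a b : ℂ) (n k : ℕ) (hk : 1 + a + 2 * n - b + k ≠ 0) :
    kummerF a b n (k + 1) * ((1 + a + 2 * n - b + k) * (k + 1)) =
      -(kummerF a b n k * ((a + 2 * n + k) * (b + k))) := by
  have hk1 : (k : ℂ) + 1 ≠ 0 := Nat.cast_add_one_ne_zero k
  have hf : (k.factorial : ℂ) ≠ 0 := Nat.cast_ne_zero.2 k.factorial_ne_zero
  simp only [kummerF, poch_succ, Nat.factorial_succ, pow_succ]
  push_cast
  generalize Gamma (1 + a + 2 * n) * Gamma (1 + a / 2 + n - b) /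
    (Gamma (1 + a / 2 + n) * Gamma (1 + a + 2 * n - b)) = g
  by_cases hp : poch (1 + a + 2 * n - b) k = 0
  · simp [hp]
  field_simp

theorem kummerF_succ_left (a b : ℂ) (n k : ℕ) (h0 : a + 2 * (n : ℂ) ≠ 0)
    (h1 : ∀ k : ℕ, 1 + a + 2 * (n : ℂ) - b + k ≠ 0)
    (h3 : Gamma (1 + a + 2 * (n : ℂ)) ≠ 0)
    (h4 : Gamma (1 + a / 2 + (n : ℂ) - b) ≠ 0)
    (h5 : Gamma (1 + a / 2 + (n : ℂ)) ≠ 0)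
    (h6 : Gamma (1 + a + 2 * (n : ℂ) - b) ≠ 0) :
    kummerF a b (n + 1) k * ((a + 2 * n) * ((1 + a + 2 * n - b + k) *
        (1 + a + 2 * n - b + k + 1))) =
      kummerF a b n k * ((a + 2 * n + k) * (a + 2 * n + k + 1) * (a + 2 * n + 2 - 2 * b)) := by
  obtain ⟨A, hA⟩ : ∃ A, A = a + 2 * (n : ℂ) := ⟨_, rfl⟩
  obtain rfl : a = A - 2 * n := by rw [hA]; ring
  have e1 : A - 2 * n + 2 * (n : ℂ) = A := by ring
  have e2 : 1 + (A - 2 * n) + 2 * (n : ℂ) = 1 + A := by ring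
  have e3 : 1 + (A - 2 * n) / 2 + (n : ℂ) = 1 + A / 2 := by ring
  have e4 : A - 2 * n + 2 * ((n : ℂ) + 1) = A + 1 + 1 := by ring
  have e5 : 1 + (A - 2 * n) + 2 * ((n : ℂ) + 1) = 1 + A + 1 + 1 := by ring
  have e6 : 1 + (A - 2 * n) / 2 + ((n : ℂ) + 1) = 1 + A / 2 + 1 := by ring
  have e7 : 1 + A + 1 + 1 - b = 1 + A - b + 1 + 1 := by ring
  have e8 : 1 + A / 2 + 1 - b = 1 + A / 2 - b + 1 := by ring
  have hz0 {z : ℂ} (hz : Gamma z ≠ 0) : z ≠ 0 := by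
    simpa using add_natCast_ne_zero_of_Gamma_ne_zero hz 0
  have hz1 {z : ℂ} (hz : Gamma z ≠ 0) : z + 1 ≠ 0 := by
    simpa using add_natCast_ne_zero_of_Gamma_ne_zero hz 1
  simp only [kummerF, Nat.cast_add_one, e1, e2, e3, e4, e5, e6, e7, e8] at *
  rw [Gamma_add_one _ (hz1 h3), Gamma_add_one _ (hz0 h3), Gamma_add_one _ (hz0 h4),
    Gamma_add_one _ (hz0 h5), Gamma_add_one _ (hz1 h6), Gamma_add_one _ (hz0 h6)]
  have hp := poch_ne_zero h1 k
  have hp2 : poch (1 + A - b + 1 + 1) k ≠ 0 := poch_ne_zero (fun j => by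
    convert h1 (j + 2) using 1
    push_cast
    ring) k
  have hf : (k.factorial : ℂ) ≠ 0 := Nat.cast_ne_zero.2 k.factorial_ne_zero
  have hA1 : A + 1 ≠ 0 := by simpa [add_comm] using hz0 h3
  have hC := hz0 h6
  have hC1 := hz1 h6
  have hA2 := hz0 h5
  have hA2' : 2 + A ≠ 0 := fun h => hA2 (by linear_combination h / 2)
  have hnum : poch (A + 1 + 1) k * (A * (A + 1)) = poch A k * ((A + k) * (A + k + 1)) := by
    linear_combination A * poch_add_one_mul (A + 1) k + (A + 1 + k) * poch_add_one_mul A k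
  have hden : poch (1 + A - b + 1 + 1) k * ((1 + A - b) * (1 + A - b + 1)) =
      poch (1 + A - b) k * ((1 + A - b + k) * (1 + A - b + k + 1)) := by
    linear_combination (1 + A - b) * poch_add_one_mul (1 + A - b + 1) k +
      (1 + A - b + 1 + k) * poch_add_one_mul (1 + A - b) k
  have hk := h1 k
  have hk1 : 1 + A - b + k + 1 ≠ 0 := by
    convert h1 (k + 1) using 1
    push_cast
    ring
  rw [eq_div_of_mul_eq (mul_ne_zero h0 hA1) hnum, eq_div_of_mul_eq (mul_ne_zero hC hC1) hden,
    show 1 + A / 2 - b = (A + 2 - 2 * b) / 2 by ring, show 1 + A / 2 = (2 + A) / 2 by ring,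
    show 1 + A = A + 1 by ring] at *
  generalize A + 1 - b = C at *
  generalize Gamma C = G4 at *
  generalize Gamma (A + 1) = G1 at *
  generalize Gamma ((2 + A) / 2) = G3 at *
  generalize Gamma ((A + 2 - 2 * b) / 2) = G2 at *
  field_simp
  ring

/-- The summed form of the WZ identity `F(n+1,k) - F(n,k) = H(n,k+1) - H(n,k)`, where
`H(n,k) = F(n,k) (b-1) k / ((1+a+2n-b+k)(a+2n))`. -/
theorem sum_kummerF_succ_sub (a b : ℂ) (n N : ℕ) (h0 : a + 2 * (n : ℂ) ≠ 0)
    (h1 : ∀ k : ℕ, 1 + a + 2 * (n : ℂ) - b + k ≠ 0)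
    (h3 : Gamma (1 + a + 2 * (n : ℂ)) ≠ 0)
    (h4 : Gamma (1 + a / 2 + (n : ℂ) - b) ≠ 0)
    (h5 : Gamma (1 + a / 2 + (n : ℂ)) ≠ 0)
    (h6 : Gamma (1 + a + 2 * (n : ℂ) - b) ≠ 0) :
    ∑ k ∈ range N, (kummerF a b (n + 1) k - kummerF a b n k) =
      kummerF a b n N * ((b - 1) / (a + 2 * n) * ((0 + N) / (1 + a + 2 * n - b + N))) := by
  induction N with
  | zero => simp
  | succ k ih =>
    have hk := h1 k
    have hk1 : 1 + a + 2 * (n : ℂ) - b + k + 1 ≠ 0 := by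
      convert h1 (k + 1) using 1
      push_cast
      ring
    have hk2 : (k : ℂ) + 1 ≠ 0 := Nat.cast_add_one_ne_zero k
    have hl := kummerF_succ_left a b n k h0 h1 h3 h4 h5 h6
    have hr := kummerF_succ_right a b n k hk
    rw [sum_range_succ, ih, eq_div_of_mul_eq (mul_ne_zero h0 (mul_ne_zero hk hk1)) hl,
      eq_div_of_mul_eq (mul_ne_zero hk hk2) hr]
    push_cast
    generalize kummerF a b n k = F
    obtain ⟨C, hC⟩ : ∃ C, C = 1 + a + 2 * (n : ℂ) - b := ⟨_, rfl⟩
    have hb : b = 1 + a + 2 * (n : ℂ) - C := by rw [hC]; ring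
    rw [← hC] at hk hk1 ⊢
    rw [← add_assoc C]
    field_simp
    rw [hb]
    ring

theorem summable_kummerF (a : ℂ) {b : ℂ} (hb : b.re < 0) (n : ℕ) :
    Summable fun k : ℕ => kummerF a b n k := by
  have h := summable_kummer_term (a + 2 * n) hb
  rw [← add_assoc] at h
  exact h.mul_right _

theorem tsum_kummerF_succ {a b : ℂ} (hb : b.re < 0) (n : ℕ) (h0 : a + 2 * (n : ℂ) ≠ 0)
    (h1 : ∀ k : ℕ, 1 + a + 2 * (n : ℂ) - b + k ≠ 0)
    (h3 : Gamma (1 + a + 2 * (n : ℂ)) ≠ 0)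
    (h4 : Gamma (1 + a / 2 + (n : ℂ) - b) ≠ 0)
    (h5 : Gamma (1 + a / 2 + (n : ℂ)) ≠ 0)
    (h6 : Gamma (1 + a + 2 * (n : ℂ) - b) ≠ 0) :
    ∑' k, kummerF a b (n + 1) k = ∑' k, kummerF a b n k := by
  have hs := summable_kummerF a hb n
  have hs' := summable_kummerF a hb (n + 1)
  have hlim := hs.tendsto_atTop_zero.mul ((tendsto_add_div_add_natCast 0
    (1 + a + 2 * n - b)).const_mul ((b - 1) / (a + 2 * n)))
  rw [zero_mul] at hlim
  rw [← sub_eq_zero, ← hs'.tsum_sub hs]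
  refine tendsto_nhds_unique (hs'.sub hs).hasSum.tendsto_sum_nat (hlim.congr fun N => ?_)
  exact (sum_kummerF_succ_sub a b n N h0 h1 h3 h4 h5 h6).symm

/-- WZ sum equals 1 for `Re b < 0`: `∑_k F(n,k) = 1` for every `n`; equivalently,
`∑_k (a+2n)_k (b)_k (-1)^k / ((1+a+2n-b)_k k!)
  = Γ(1+a/2+n) Γ(1+a+2n-b) / (Γ(1+a+2n) Γ(1+a/2+n-b))`. -/
theorem kummer_WZ_sum_eq_one (a b : ℂ) (hb : b.re < 0)
    (h0 : ∀ n : ℕ, a + 2 * (n : ℂ) ≠ 0)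
    (h1 : ∀ n k : ℕ, 1 + a + 2 * (n : ℂ) - b + (k : ℂ) ≠ 0)
    (h2 : ∀ n m : ℕ, 1 + a + 2 * (n : ℂ) - b ≠ -(m : ℂ))
    (h3 : ∀ n : ℕ, Gamma (1 + a + 2 * (n : ℂ)) ≠ 0)
    (h4 : ∀ n : ℕ, Gamma (1 + a / 2 + (n : ℂ) - b) ≠ 0)
    (h5 : ∀ n : ℕ, Gamma (1 + a / 2 + (n : ℂ)) ≠ 0)
    (h6 : ∀ n : ℕ, Gamma (1 + a + 2 * (n : ℂ) - b) ≠ 0) :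
    ∀ n : ℕ,
      HasSum (fun k : ℕ => kummerF a b n k) 1 ∧
      HasSum (fun k : ℕ =>
          poch (a + 2 * n) k * poch b k * (-1 : ℂ) ^ k /
            (poch (1 + a + 2 * n - b) k * (Nat.factorial k : ℂ)))
        (Gamma (1 + a / 2 + n) * Gamma (1 + a + 2 * n - b) /
          (Gamma (1 + a + 2 * n) * Gamma (1 + a / 2 + n - b))) := by
  have hconst : ∀ n : ℕ, ∑' k, kummerF a b n k = ∑' k, kummerF a b 0 k := by
    intro n
    induction n with
    | zero => rfl
    | succ n ih =>
      rw [tsum_kummerF_succ hb n (h0 n) (h1 n) (h3 n) (h4 n) (h5 n) (h6 n), ih]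
  have hlim : Tendsto (fun n : ℕ => ∑' k, kummerF a b n k) atTop (𝓝 1) := by
    have h := (tendsto_tsum_kummer_term a hb).mul (tendsto_Gamma_ratio
      (by simpa using h3 0) (by simpa using h4 0) (by simpa using h5 0) (by simpa using h6 0))
    rw [← cpow_add _ _ two_ne_zero, neg_add_cancel, cpow_zero] at h
    exact h.congr fun n => tsum_mul_right.symm
  have hone : ∑' k, kummerF a b 0 k = 1 :=
    tendsto_nhds_unique (tendsto_const_nhds.congr fun n => (hconst n).symm) hlim
  intro n
  have hF : HasSum (fun k => kummerF a b n k) 1 := by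
    rw [← hone, ← hconst n]
    exact (summable_kummerF a hb n).hasSum
  refine ⟨hF, ?_⟩
  have h := hF.mul_right (Gamma (1 + a / 2 + n) * Gamma (1 + a + 2 * n - b) /
    (Gamma (1 + a + 2 * n) * Gamma (1 + a / 2 + n - b)))
  rw [one_mul] at h
  refine h.congr_fun fun k => ?_
  rw [kummerF, mul_assoc (_ / _) (_ / _) (_ / _), div_mul_div_comm (_ * _), mul_comm (Gamma (1 + a + 2 * n) * _), div_self, mul_one]
  exact mul_ne_zero (mul_ne_zero (h5 n) (h6 n)) (mul_ne_zero (h3 n) (h4 n))
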